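/- arXiv:1211.5996 — 2 statements merged into one kernel-verified Lean document; each statement's English description precedes it below -/
import Mathlib

section
/- Let δ = (log 2)/(2π), α = −2.5/δ, β = 2.5/δ, and let S_− be the Selberg minorant for the interval [α, β] with parameter δ. Then S_−(x) > 0 for every real x with α < x < β. -/
open Real MeasureTheory
open scoped Classical

/-- The Beurling function on `ℝ`, with its removable singularities at the
nonpositive integers filled in by the limiting values: `B(z) = 1 + 2 (sin(πz)/π)^2
(1/z − Σ_{n=1}^∞ 1/(n+z)^2)` off the nonpositive integers (the formula already
yields the limiting value `1` at `z = 0`), and `B(−m) = −1` for integers `m ≥ 1`. -/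
noncomputable def beurlingB (x : ℝ) : ℝ :=
  if ∃ m : ℕ, x = -((m : ℝ) + 1) then -1
  else 1 + 2 * (Real.sin (Real.pi * x) / Real.pi) ^ 2 *
    (1 / x - ∑' n : ℕ, 1 / (((n : ℝ) + 1) + x) ^ 2)

/-- The Selberg minorant for the interval `[α, β]` with parameter `δ`:
`S₋(x) = −(1/2) (B(δ(α − x)) + B(δ(x − β)))`. -/
noncomputable def selbergMinus (α β δ : ℝ) (x : ℝ) : ℝ :=
  -(1 / 2) * (beurlingB (δ * (α - x)) + beurlingB (δ * (x - β)))

/-- The Fourier coefficients of `x ↦ exp (2 * π * I * u * x)` on `[-1/2, 1/2]`. -/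
theorem fourierCoeffOn_exp_mul (u : ℝ) (hu : ∀ n : ℤ, u ≠ n) (n : ℤ) :
    fourierCoeffOn (show (-1 / 2 : ℝ) < 1 / 2 by norm_num)
        (fun x : ℝ => Complex.exp (2 * π * Complex.I * u * x)) n =
      ((Real.sin (π * (u - n)) / (π * (u - n)) : ℝ) : ℂ) := by
  have hun : (u : ℂ) - n ≠ 0 := by
    have := sub_ne_zero.mpr (hu n)
    exact_mod_cast this
  have hπ : (π : ℂ) ≠ 0 := by exact_mod_cast Real.pi_ne_zero
  have hc : 2 * π * Complex.I * ((u : ℂ) - n) ≠ 0 := by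
    simp [hπ, hun]
  have hint : ∀ x : ℝ, fourier (-n) (x : AddCircle ((1 / 2 : ℝ) - (-1 / 2))) •
      Complex.exp (2 * π * Complex.I * u * x) =
      Complex.exp (2 * π * Complex.I * ((u : ℂ) - n) * x) := by
    intro x
    rw [fourier_coe_apply, smul_eq_mul, ← Complex.exp_add]
    congr 1
    push_cast
    ring
  rw [fourierCoeffOn_eq_integral]
  simp_rw [hint]
  rw [integral_exp_mul_complex hc]
  push_cast
  rw [Complex.sin]
  have h1 : 2 * π * Complex.I * ((u : ℂ) - n) * (1 / 2) = π * (u - n) * Complex.I := by ring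
  have h2 : 2 * π * Complex.I * ((u : ℂ) - n) * (-1 / 2) = -(π * (u - n)) * Complex.I := by ring
  rw [h1, h2, Complex.real_smul]
  generalize Complex.exp (π * (u - n) * Complex.I) = p
  generalize Complex.exp (-(π * (u - n)) * Complex.I) = q
  push_cast
  field_simp
  ring_nf
  simp only [Complex.I_sq]
  ring

theorem Real.sin_pi_mul_sub_intCast_sq (u : ℝ) (n : ℤ) :
    Real.sin (π * (u - n)) ^ 2 = Real.sin (π * u) ^ 2 := by
  rw [show π * (u - n) = π * u - n * π by ring, Real.sin_sub_int_mul_pi, mul_pow, ← zpow_natCast,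
    ← zpow_mul, mul_comm n, zpow_mul]
  norm_num

theorem Real.sin_pi_mul_ne_zero_of_forall_ne_intCast {u : ℝ} (hu : ∀ n : ℤ, u ≠ n) :
    Real.sin (π * u) ≠ 0 := by
  rw [Real.sin_ne_zero_iff]
  intro n hn
  rw [mul_comm] at hn
  exact hu n (mul_left_cancel₀ Real.pi_ne_zero hn).symm

/-- The partial fraction expansion of `(π / sin (π * u)) ^ 2`. -/
theorem hasSum_one_div_intCast_sub_sq {u : ℝ} (hu : ∀ n : ℤ, u ≠ n) :
    HasSum (fun n : ℤ => 1 / ((n : ℝ) - u) ^ 2) ((π / Real.sin (π * u)) ^ 2) := by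
  have hs := Real.sin_pi_mul_ne_zero_of_forall_ne_intCast hu
  have hnorm : ∀ x : ℝ, ‖Complex.exp (2 * π * Complex.I * u * x)‖ = 1 := by
    intro x
    rw [show 2 * π * Complex.I * u * x = ((2 * π * u * x : ℝ) : ℂ) * Complex.I by
      push_cast; ring]
    exact Complex.norm_exp_ofReal_mul_I _
  have hL2 : MemLp (fun x : ℝ => Complex.exp (2 * π * Complex.I * u * x)) 2
      (volume.restrict (Set.Ioc (-1 / 2 : ℝ) (1 / 2))) :=
    MemLp.of_bound (Continuous.aestronglyMeasurable (by fun_prop)) 1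
      (Filter.Eventually.of_forall fun x => (hnorm x).le)
  have h := hasSum_sq_fourierCoeffOn (show (-1 / 2 : ℝ) < 1 / 2 by norm_num) hL2
  simp_rw [fourierCoeffOn_exp_mul u hu, hnorm, Complex.norm_real, Real.norm_eq_abs, sq_abs,
    div_pow, Real.sin_pi_mul_sub_intCast_sq] at h
  have h' := h.mul_left ((π / Real.sin (π * u)) ^ 2)
  have hint : ((1 / 2 - -1 / 2 : ℝ)⁻¹ • ∫ _ in (-1 / 2 : ℝ)..1 / 2, (1 : ℝ) ^ 2) = 1 := by
    norm_num
  rw [hint, mul_one] at h'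
  refine h'.congr_fun fun n => ?_
  have hn := sub_ne_zero.mpr (hu n)
  rw [← neg_sub u, neg_sq]
  generalize Real.sin (π * u) = s at hs
  field_simp

theorem beurlingB_of_forall_ne_intCast {x : ℝ} (hx : ∀ n : ℤ, x ≠ n) :
    beurlingB x = 1 + 2 * (Real.sin (Real.pi * x) / Real.pi) ^ 2 *
      (1 / x - ∑' n : ℕ, 1 / (((n : ℝ) + 1) + x) ^ 2) := by
  refine if_neg ?_
  rintro ⟨m, hm⟩
  exact hx (-((m : ℤ) + 1)) (by rw [hm]; push_cast; ring)

theorem beurlingB_neg_natCast_add_one (m : ℕ) : beurlingB (-((m : ℝ) + 1)) = -1 :=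
  if_pos ⟨m, rfl⟩

/-- The two half-line sums in the Selberg minorant for an interval of length `5` overlap
in exactly four terms. -/
theorem tsum_add_tsum_one_div_sq {u : ℝ} (hu : ∀ n : ℤ, u ≠ n) :
    (∑' n : ℕ, 1 / (((n : ℝ) + 1) + -u) ^ 2) + ∑' n : ℕ, 1 / (((n : ℝ) + 1) + (u - 5)) ^ 2 =
      (π / Real.sin (π * u)) ^ 2 +
        (1 / (4 - u) ^ 2 + 1 / (3 - u) ^ 2 + 1 / (2 - u) ^ 2 + 1 / (1 - u) ^ 2) := by
  have hZ := (Equiv.addRight (1 : ℤ)).hasSum_iff.mpr (hasSum_one_div_intCast_sub_sq hu)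
  have hinj : Function.Injective fun n : ℕ => -((n : ℤ) + 1) := fun a b h => by
    simpa using h
  have h1 := hZ.summable.comp_injective Nat.cast_injective
  have h2 := hZ.summable.comp_injective hinj
  have hsum := (HasSum.of_nat_of_neg_add_one h1.hasSum h2.hasSum).unique hZ
  have e1 : (fun n : ℕ => 1 / (((n : ℝ) + 1) + -u) ^ 2) =
      ((fun n : ℤ => 1 / ((n : ℝ) - u) ^ 2) ∘ Equiv.addRight (1 : ℤ)) ∘ Nat.cast := by
    ext n
    simp [sub_eq_add_neg]
  have e2 : (fun n : ℕ => 1 / (((n + 4 : ℕ) : ℝ) + 1 + (u - 5)) ^ 2) =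
      ((fun n : ℤ => 1 / ((n : ℝ) - u) ^ 2) ∘ Equiv.addRight (1 : ℤ)) ∘
        fun n : ℕ => -((n : ℤ) + 1) := by
    ext n
    simp only [Function.comp_apply, Equiv.coe_addRight]
    push_cast
    congr 1
    ring
  have h3 : Summable fun n : ℕ => 1 / ((n : ℝ) + 1 + (u - 5)) ^ 2 :=
    (summable_nat_add_iff 4).mp (e2 ▸ h2)
  rw [← h3.sum_add_tsum_nat_add 4, e1, e2, ← hsum]
  simp only [Finset.sum_range_succ, Finset.sum_range_zero]
  push_cast
  rw [show (0 : ℝ) + 1 + (u - 5) = -(4 - u) by ring, show (1 : ℝ) + 1 + (u - 5) = -(3 - u) by ring,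
    show (2 : ℝ) + 1 + (u - 5) = -(2 - u) by ring, show (3 : ℝ) + 1 + (u - 5) = -(1 - u) by ring]
  simp only [neg_sq]
  ring

theorem beurlingB_add_beurlingB_neg {u : ℝ} (h0 : 0 < u) (h5 : u < 5) :
    beurlingB (-u) + beurlingB (u - 5) < 0 := by
  by_cases hu : ∀ n : ℤ, u ≠ n
  · have hs := Real.sin_pi_mul_ne_zero_of_forall_ne_intCast hu
    have hs1 : Real.sin (π * -u) ^ 2 = Real.sin (π * u) ^ 2 := by
      rw [mul_neg, Real.sin_neg, neg_sq]
    have hs2 : Real.sin (π * (u - 5)) ^ 2 = Real.sin (π * u) ^ 2 := by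
      exact_mod_cast Real.sin_pi_mul_sub_intCast_sq u 5
    rw [beurlingB_of_forall_ne_intCast (x := -u) fun n hn => hu (-n) (by
        push_cast; linarith),
      beurlingB_of_forall_ne_intCast (x := u - 5) fun n hn => hu (n + 5) (by
        push_cast; linarith), div_pow, div_pow, hs1, hs2]
    have hsum := tsum_add_tsum_one_div_sq hu
    have hspos : 0 < Real.sin (π * u) ^ 2 / π ^ 2 := by positivity
    have hcancel : Real.sin (π * u) ^ 2 / π ^ 2 * (π / Real.sin (π * u)) ^ 2 = 1 := by
      field_simp
    have hu5 : 1 / (u - 5) < 0 := one_div_neg.mpr (by linarith)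
    have hu0 : 1 / -u < 0 := one_div_neg.mpr (by linarith)
    have hover : 0 ≤ 1 / (4 - u) ^ 2 + 1 / (3 - u) ^ 2 + 1 / (2 - u) ^ 2 + 1 / (1 - u) ^ 2 := by
      positivity
    have hneg := mul_neg_of_pos_of_neg hspos
      (show 1 / -u + 1 / (u - 5) -
        (1 / (4 - u) ^ 2 + 1 / (3 - u) ^ 2 + 1 / (2 - u) ^ 2 + 1 / (1 - u) ^ 2) < 0 by linarith)
    linear_combination 2 * hneg - 2 * (Real.sin (π * u) ^ 2 / π ^ 2) * hsum - 2 * hcancel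
  · push Not at hu
    obtain ⟨n, rfl⟩ := hu
    have h0' : 0 < n := by exact_mod_cast h0
    have h5' : n < 5 := by exact_mod_cast h5
    obtain ⟨k, rfl⟩ : ∃ k : ℕ, n = k + 1 := ⟨(n - 1).toNat, by lia⟩
    obtain ⟨l, hl⟩ : ∃ l : ℕ, (k : ℤ) + l = 3 := ⟨3 - k, by lia⟩
    have hl' : (k : ℝ) + l = 3 := by exact_mod_cast hl
    push_cast
    rw [beurlingB_neg_natCast_add_one,
      show (k : ℝ) + 1 - 5 = -((l : ℝ) + 1) by linarith, beurlingB_neg_natCast_add_one]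
    norm_num

/-- with `δ = (log 2)/(2π)`, `α = −2.5/δ`, `β = 2.5/δ`, the Selberg
minorant for `[α, β]` with parameter `δ` is strictly positive on `(α, β)`. -/
theorem selbergMinus_pos_on_interval :
    ∀ x : ℝ,
      -2.5 / (Real.log 2 / (2 * Real.pi)) < x →
      x < 2.5 / (Real.log 2 / (2 * Real.pi)) →
      0 < selbergMinus (-2.5 / (Real.log 2 / (2 * Real.pi)))
            (2.5 / (Real.log 2 / (2 * Real.pi))) (Real.log 2 / (2 * Real.pi)) x := by
  intro x hα hβ
  have hδ : 0 < Real.log 2 / (2 * Real.pi) :=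
    div_pos (Real.log_pos one_lt_two) (by positivity)
  generalize Real.log 2 / (2 * Real.pi) = δ at *
  rw [div_lt_iff₀ hδ] at hα
  rw [lt_div_iff₀ hδ] at hβ
  have h := beurlingB_add_beurlingB_neg (u := x * δ + 2.5) (by linarith) (by linarith)
  rw [selbergMinus, show δ * (-2.5 / δ - x) = -(x * δ + 2.5) by field_simp; ring,
    show δ * (x - 2.5 / δ) = x * δ + 2.5 - 5 by field_simp; ring]
  linarith
end

section
/- Let δ = (log 2)/(2π), let α < β be any real numbers, and let S_− be the Selberg minorant for the interval [α, β] with parameter δ. Then for every integer n ≥ 2, the Fourier transform of S_− vanishes at ±(log n)/(2π): Ŝ_−((log n)/(2π)) = 0 and Ŝ_−(−(log n)/(2π)) = 0. -/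
open Real MeasureTheory
open scoped Classical

/-- The Fourier transform `f̂(x) = ∫_{−∞}^∞ f(u) e^{−2πiux} du` of a real-valued
function on `ℝ`. -/
noncomputable def fourierT (f : ℝ → ℝ) (x : ℝ) : ℂ :=
  ∫ u : ℝ, (f u : ℂ) * Complex.exp (-(2 * Real.pi * u * x) * Complex.I)

open scoped FourierTransform

theorem fourierT_eq_fourier (f : ℝ → ℝ) (x : ℝ) :
    fourierT f x = 𝓕 (fun u => (f u : ℂ)) x := by
  rw [Real.fourier_real_eq_integral_exp_smul, fourierT]
  congr 1 with u
  rw [smul_eq_mul, mul_comm]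
  push_cast
  congr 2
  ring

/-- The triangle function, whose Fourier transform is the Fejér kernel. -/
noncomputable def triangle (t : ℝ) : ℂ := ((1 - min |t| 1 : ℝ) : ℂ)

/-- A function supported on `[-1, 1]` whose Fourier transform is a product of two translates of
the normalized sinc function. -/
noncomputable def sineBump (t : ℝ) : ℂ :=
  Complex.exp (Real.pi * Complex.I * t) * ((Real.sin (Real.pi * min |t| 1) / Real.pi : ℝ) : ℂ)

theorem continuous_triangle : Continuous triangle := by
  unfold triangle; fun_prop

theorem continuous_sineBump : Continuous sineBump := by
  unfold sineBump; fun_prop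

theorem triangle_eq_zero {t : ℝ} (ht : 1 ≤ |t|) : triangle t = 0 := by
  simp [triangle, min_eq_right ht]

theorem sineBump_eq_zero {t : ℝ} (ht : 1 ≤ |t|) : sineBump t = 0 := by
  simp [sineBump, min_eq_right ht]

theorem integrable_of_continuous_of_eq_zero {h : ℝ → ℂ} (hc : Continuous h)
    (h0 : ∀ t : ℝ, 1 ≤ |t| → h t = 0) : Integrable h := by
  apply hc.integrable_of_hasCompactSupport
  apply HasCompactSupport.intro (isCompact_Icc (a := (-1 : ℝ)) (b := 1))
  intro t ht
  apply h0
  by_contra! hlt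
  exact ht ⟨(abs_lt.1 hlt).1.le, (abs_lt.1 hlt).2.le⟩

theorem fourier_eq_integral_add_integral {h : ℝ → ℂ} (hc : Continuous h)
    (h0 : ∀ t : ℝ, 1 ≤ |t| → h t = 0) (y : ℝ) :
    𝓕 h y = (∫ t in (-1 : ℝ)..0, Complex.exp (-(2 * Real.pi * Complex.I * y) * t) * h t) +
      ∫ t in (0 : ℝ)..1, Complex.exp (-(2 * Real.pi * Complex.I * y) * t) * h t := by
  have hint : ∀ a b : ℝ, IntervalIntegrable
      (fun t : ℝ => Complex.exp (-(2 * Real.pi * Complex.I * y) * t) * h t) volume a b :=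
    fun a b => Continuous.intervalIntegrable (by fun_prop) a b
  rw [intervalIntegral.integral_add_adjacent_intervals (hint _ _) (hint _ _),
    intervalIntegral.integral_of_le (by norm_num), Real.fourier_real_eq_integral_exp_smul,
    setIntegral_eq_integral_of_forall_compl_eq_zero]
  · congr 1 with t
    rw [smul_eq_mul]
    push_cast
    congr 2
    ring
  · intro t ht
    rw [h0, mul_zero]
    by_contra! hlt
    exact ht ⟨(abs_lt.1 hlt).1, (abs_lt.1 hlt).2.le⟩

theorem exp_add_exp_neg_sub_two (y : ℝ) :
    Complex.exp (-(2 * Real.pi * Complex.I * y)) + Complex.exp (2 * Real.pi * Complex.I * y) - 2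
      = -4 * (Real.sin (Real.pi * y) : ℂ) ^ 2 := by
  have h1 : Complex.exp (2 * Real.pi * Complex.I * y)
      = Complex.exp (Real.pi * y * Complex.I) ^ 2 := by
    rw [← Complex.exp_nat_mul]; congr 1; push_cast; ring
  have h2 : Complex.exp (-(2 * Real.pi * Complex.I * y))
      = Complex.exp (-(Real.pi * y) * Complex.I) ^ 2 := by
    rw [← Complex.exp_nat_mul]; congr 1; push_cast; ring
  have h3 : Complex.exp (-(Real.pi * y) * Complex.I) * Complex.exp (Real.pi * y * Complex.I)
      = 1 := by
    rw [← Complex.exp_add]; simp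
  rw [h1, h2, Complex.ofReal_sin, Complex.sin, Complex.ofReal_mul]
  linear_combination (2 : ℂ) * h3 + (Complex.exp (-(Real.pi * y) * Complex.I) -
    Complex.exp (Real.pi * y * Complex.I)) ^ 2 * Complex.I_sq

theorem fourier_triangle {y : ℝ} (hy : y ≠ 0) :
    𝓕 triangle y = (((Real.sin (Real.pi * y) / Real.pi) ^ 2 / y ^ 2 : ℝ) : ℂ) := by
  rw [fourier_eq_integral_add_integral continuous_triangle (fun t => triangle_eq_zero)]
  have hE := exp_add_exp_neg_sub_two y
  have hpi : (Real.pi : ℂ) ≠ 0 := by exact_mod_cast Real.pi_ne_zero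
  have hyc : (y : ℂ) ≠ 0 := by exact_mod_cast hy
  have hc : -(2 * Real.pi * Complex.I * y) ≠ 0 := by simp [hpi, hyc]
  have hc2 : (-(2 * Real.pi * Complex.I * y)) ^ 2 = -4 * Real.pi ^ 2 * y ^ 2 := by
    linear_combination 4 * (Real.pi : ℂ) ^ 2 * y ^ 2 * Complex.I_sq
  have hneg : (2 * Real.pi * Complex.I * y) = - -(2 * Real.pi * Complex.I * y) := by ring
  rw [hneg] at hE
  simp only [neg_neg (-(2 * Real.pi * Complex.I * (y : ℂ)))] at hE
  set c : ℂ := -(2 * Real.pi * Complex.I * y)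
  have hexp : ∀ t : ℝ, HasDerivAt (fun t : ℝ => Complex.exp (c * t)) (Complex.exp (c * t) * c) t :=
    fun t => by
      simpa using ((Complex.ofRealCLM.hasDerivAt (x := t)).const_mul c).cexp
  have hid : ∀ t : ℝ, HasDerivAt (fun t : ℝ => (t : ℂ)) 1 t :=
    fun t => Complex.ofRealCLM.hasDerivAt
  have e1 : ∫ t in (-1 : ℝ)..0, Complex.exp (c * t) * triangle t
      = (1 / c - 1 / c ^ 2) + Complex.exp (-c) / c ^ 2 := by
    rw [intervalIntegral.integral_congr (g := fun t : ℝ => Complex.exp (c * t) * (1 + t)),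
      intervalIntegral.integral_eq_sub_of_hasDerivAt
        (f := fun t : ℝ => Complex.exp (c * t) * ((1 + t) / c - 1 / c ^ 2))]
    · simp; ring
    · intro t _
      refine ((hexp t).fun_mul
        ((((hid t).const_add 1).div_const c).sub_const (1 / c ^ 2))).congr_deriv ?_
      field_simp
      ring
    · exact Continuous.intervalIntegrable (by fun_prop) _ _
    · intro t ht
      rw [Set.uIcc_of_le (by norm_num)] at ht
      have : min |t| 1 = -t := by
        rw [abs_of_nonpos ht.2, min_eq_left (by linarith [ht.1])]
      simp [triangle, this]
  have e2 : ∫ t in (0 : ℝ)..1, Complex.exp (c * t) * triangle t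
      = Complex.exp c / c ^ 2 - (1 / c + 1 / c ^ 2) := by
    rw [intervalIntegral.integral_congr (g := fun t : ℝ => Complex.exp (c * t) * (1 - t)),
      intervalIntegral.integral_eq_sub_of_hasDerivAt
        (f := fun t : ℝ => Complex.exp (c * t) * ((1 - t) / c + 1 / c ^ 2))]
    · simp; ring
    · intro t _
      refine ((hexp t).fun_mul
        ((((hid t).const_sub 1).div_const c).add_const (1 / c ^ 2))).congr_deriv ?_
      field_simp
      ring
    · exact Continuous.intervalIntegrable (by fun_prop) _ _
    · intro t ht
      rw [Set.uIcc_of_le (by norm_num)] at ht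
      have : min |t| 1 = t := by
        rw [abs_of_nonneg ht.1, min_eq_left ht.2]
      simp [triangle, this]
  rw [e1, e2]
  trans (Complex.exp c + Complex.exp (-c) - 2) / c ^ 2
  · ring
  · rw [hE, hc2]
    push_cast
    field_simp

theorem integral_exp_sub_integral_exp {y : ℝ} (hy : y ≠ 0) :
    (∫ t in (0 : ℝ)..1, Complex.exp (-(2 * Real.pi * Complex.I * y) * t)) -
      ∫ t in (-1 : ℝ)..0, Complex.exp (-(2 * Real.pi * Complex.I * y) * t)
      = 2 * Real.sin (Real.pi * y) ^ 2 / (Real.pi * Complex.I * y) := by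
  have hE := exp_add_exp_neg_sub_two y
  have hpi : (Real.pi : ℂ) ≠ 0 := by exact_mod_cast Real.pi_ne_zero
  have hyc : (y : ℂ) ≠ 0 := by exact_mod_cast hy
  have hc : -(2 * Real.pi * Complex.I * y) ≠ 0 := by simp [hpi, hyc]
  rw [integral_exp_mul_complex hc, integral_exp_mul_complex hc]
  simp only [Complex.ofReal_one, Complex.ofReal_zero, Complex.ofReal_neg, mul_zero, mul_one,
    Complex.exp_zero, mul_neg, neg_neg]
  rw [← sub_div, sub_sub_sub_comm]
  trans (-4 * (Real.sin (Real.pi * y) : ℂ) ^ 2) / -(2 * Real.pi * Complex.I * y)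
  · rw [← hE]; ring
  · have := Complex.I_ne_zero
    field_simp
    norm_num
    ring

theorem fourier_sineBump {y : ℝ} (hy : y ≠ 0) (hy1 : y - 1 ≠ 0) :
    𝓕 sineBump y =
      (((Real.sin (Real.pi * y) / Real.pi) ^ 2 * (1 / y - 1 / (y - 1)) : ℝ) : ℂ) := by
  rw [fourier_eq_integral_add_integral continuous_sineBump (fun t => sineBump_eq_zero)]
  have hpi : (Real.pi : ℂ) ≠ 0 := by exact_mod_cast Real.pi_ne_zero
  have hI := Complex.I_ne_zero
  have hyc : (y : ℂ) ≠ 0 := by exact_mod_cast hy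
  have hyc1 : (y : ℂ) - 1 ≠ 0 := by exact_mod_cast hy1
  have key : ∀ t : ℝ, Complex.exp (-(2 * Real.pi * Complex.I * y) * t) *
      (Complex.exp (Real.pi * Complex.I * t) * ((Real.sin (Real.pi * t) / Real.pi : ℝ) : ℂ)) =
      (2 * Real.pi * Complex.I)⁻¹ *
        (Complex.exp (-(2 * Real.pi * Complex.I * ((y - 1 : ℝ) : ℂ)) * t) -
          Complex.exp (-(2 * Real.pi * Complex.I * y) * t)) := by
    intro t
    have h1 : Complex.exp (-(2 * Real.pi * Complex.I * ((y - 1 : ℝ) : ℂ)) * t)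
        = Complex.exp (-(2 * Real.pi * Complex.I * y) * t) *
          Complex.exp (Real.pi * Complex.I * t) ^ 2 := by
      rw [← Complex.exp_nat_mul, ← Complex.exp_add]; congr 1; push_cast; ring
    have h2 : Complex.exp (-(Real.pi * t) * Complex.I) * Complex.exp (Real.pi * Complex.I * t)
        = 1 := by
      rw [← Complex.exp_add, ← Complex.exp_zero]; congr 1; ring
    have h3 : Complex.exp (Real.pi * t * Complex.I) = Complex.exp (Real.pi * Complex.I * t) := by
      ring_nf
    rw [h1, Complex.ofReal_div, Complex.ofReal_sin, Complex.sin, Complex.ofReal_mul, h3]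
    generalize Complex.exp (-(Real.pi * t) * Complex.I) = p at h2 ⊢
    generalize Complex.exp (Real.pi * Complex.I * t) = q at h2 ⊢
    field_simp
    linear_combination Complex.I ^ 2 * h2 + (1 - q ^ 2) * Complex.I_sq
  have e1 : ∫ t in (-1 : ℝ)..0, Complex.exp (-(2 * Real.pi * Complex.I * y) * t) * sineBump t
      = -((2 * Real.pi * Complex.I)⁻¹ *
        ((∫ t in (-1 : ℝ)..0, Complex.exp (-(2 * Real.pi * Complex.I * ((y - 1 : ℝ) : ℂ)) * t)) -
        ∫ t in (-1 : ℝ)..0, Complex.exp (-(2 * Real.pi * Complex.I * y) * t))) := by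
    rw [← intervalIntegral.integral_sub, ← intervalIntegral.integral_const_mul,
      ← intervalIntegral.integral_neg]
    · apply intervalIntegral.integral_congr
      intro t ht
      rw [Set.uIcc_of_le (by norm_num)] at ht
      have : min |t| 1 = -t := by
        rw [abs_of_nonpos ht.2, min_eq_left (by linarith [ht.1])]
      simp only [sineBump, this, mul_neg, Real.sin_neg, neg_div, Complex.ofReal_neg]
      rw [← key]
    all_goals exact Continuous.intervalIntegrable (by fun_prop) _ _
  have e2 : ∫ t in (0 : ℝ)..1, Complex.exp (-(2 * Real.pi * Complex.I * y) * t) * sineBump t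
      = (2 * Real.pi * Complex.I)⁻¹ *
        ((∫ t in (0 : ℝ)..1, Complex.exp (-(2 * Real.pi * Complex.I * ((y - 1 : ℝ) : ℂ)) * t)) -
        ∫ t in (0 : ℝ)..1, Complex.exp (-(2 * Real.pi * Complex.I * y) * t)) := by
    rw [← intervalIntegral.integral_sub, ← intervalIntegral.integral_const_mul]
    · apply intervalIntegral.integral_congr
      intro t ht
      rw [Set.uIcc_of_le (by norm_num)] at ht
      have : min |t| 1 = t := by
        rw [abs_of_nonneg ht.1, min_eq_left ht.2]
      simp only [sineBump, this]
      exact key t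
    all_goals exact Continuous.intervalIntegrable (by fun_prop) _ _
  have hs : Real.sin (Real.pi * (y - 1)) = -Real.sin (Real.pi * y) := by
    rw [mul_sub, mul_one, Real.sin_sub_pi]
  rw [e1, e2]
  trans (2 * Real.pi * Complex.I)⁻¹ *
    (2 * Real.sin (Real.pi * (y - 1)) ^ 2 / (Real.pi * Complex.I * ((y - 1 : ℝ) : ℂ)) -
      2 * Real.sin (Real.pi * y) ^ 2 / (Real.pi * Complex.I * y))
  · rw [← integral_exp_sub_integral_exp hy, ← integral_exp_sub_integral_exp hy1]
    ring
  · rw [hs]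
    push_cast
    field_simp
    rw [Complex.I_sq]
    ring

theorem integrable_fejer :
    Integrable fun y : ℝ => (Real.sin (Real.pi * y) / Real.pi) ^ 2 / y ^ 2 := by
  refine (integrable_inv_one_add_sq.const_mul 2).mono'
    (Measurable.aestronglyMeasurable (by fun_prop)) (Filter.Eventually.of_forall fun y => ?_)
  rw [Real.norm_of_nonneg (by positivity)]
  rcases eq_or_ne y 0 with rfl | hy
  · simp
  have hpi := Real.pi_pos
  have hy2 : 0 < y ^ 2 := by positivity
  have h1 : (Real.sin (Real.pi * y) / Real.pi) ^ 2 ≤ y ^ 2 := by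
    rw [sq_le_sq, abs_div, abs_of_pos hpi, div_le_iff₀ hpi]
    calc |Real.sin (Real.pi * y)| ≤ |Real.pi * y| := Real.abs_sin_le_abs
      _ = |y| * Real.pi := by rw [abs_mul, abs_of_pos hpi, mul_comm]
  have h2 : (Real.sin (Real.pi * y) / Real.pi) ^ 2 ≤ 1 := by
    rw [div_pow, div_le_one (by positivity)]
    nlinarith [Real.sin_sq_le_one (Real.pi * y), Real.pi_gt_three]
  rw [← div_eq_mul_inv, div_le_div_iff₀ hy2 (by positivity)]
  nlinarith

theorem integrable_fourier_triangle : Integrable (𝓕 triangle) := by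
  refine integrable_fejer.ofReal.congr ?_
  filter_upwards [(Set.countable_singleton (0 : ℝ)).ae_notMem volume] with y hy
  exact (fourier_triangle hy).symm

theorem ae_ne_zero_and_sub_one_ne_zero : ∀ᵐ y : ℝ, y ≠ 0 ∧ y - 1 ≠ 0 := by
  filter_upwards [(Set.countable_singleton (0 : ℝ)).ae_notMem volume,
    (Set.countable_singleton (1 : ℝ)).ae_notMem volume] with y hy hy1
  exact ⟨hy, sub_ne_zero.2 hy1⟩

theorem integrable_fourier_sineBump : Integrable (𝓕 sineBump) := by
  have hint : Integrable fun y : ℝ =>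
      (Real.sin (Real.pi * y) / Real.pi) ^ 2 * (1 / y - 1 / (y - 1)) := by
    refine (integrable_fejer.add (integrable_fejer.comp_sub_right 1)).mono'
      (Measurable.aestronglyMeasurable (by fun_prop)) ?_
    filter_upwards [ae_ne_zero_and_sub_one_ne_zero] with y hy
    obtain ⟨hy, hy1⟩ := hy
    have hs : Real.sin (Real.pi * (y - 1)) = -Real.sin (Real.pi * y) := by
      rw [mul_sub, mul_one, Real.sin_sub_pi]
    simp only [Pi.add_apply, hs]
    generalize Real.sin (Real.pi * y) = s
    have e : (s / Real.pi) ^ 2 * (1 / y - 1 / (y - 1))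
        = -((s / Real.pi / y) * (s / Real.pi / (y - 1))) := by
      field_simp
      ring
    rw [e, neg_div, neg_sq, ← div_pow, ← div_pow, norm_neg, Real.norm_eq_abs, abs_le]
    constructor <;>
      nlinarith [sq_nonneg (s / Real.pi / y + s / Real.pi / (y - 1)),
        sq_nonneg (s / Real.pi / y - s / Real.pi / (y - 1)),
        sq_nonneg (s / Real.pi / y), sq_nonneg (s / Real.pi / (y - 1))]
  refine hint.ofReal.congr ?_
  filter_upwards [ae_ne_zero_and_sub_one_ne_zero] with y hy
  exact (fourier_sineBump hy.1 hy.2).symm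

theorem fourier_fourier_eq_zero {h : ℝ → ℂ} (hc : Continuous h)
    (h0 : ∀ t : ℝ, 1 ≤ |t| → h t = 0) (hF : Integrable (𝓕 h)) {t : ℝ} (ht : 1 ≤ |t|) :
    𝓕 (𝓕 h) t = 0 := by
  rw [← neg_neg t, ← Real.fourierInv_eq_fourier_neg,
    hc.fourierInv_fourier_eq (integrable_of_continuous_of_eq_zero hc h0) hF]
  exact h0 _ (by rwa [abs_neg])

theorem summable_one_div_nat_add_one_add_sq (y : ℝ) :
    Summable fun n : ℕ => 1 / (((n : ℝ) + 1) + y) ^ 2 := by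
  have := (Real.summable_one_div_nat_add_rpow (1 + y) 2).2 (by norm_num)
  refine this.congr fun n => ?_
  rw [← add_assoc]
  norm_cast
  rw [sq_abs]

theorem beurlingB_sub_one_sub {y : ℝ} (hy : ∀ k : ℤ, y ≠ k) :
    beurlingB (y - 1) - beurlingB y = -2 *
      ((Real.sin (Real.pi * y) / Real.pi) ^ 2 * (1 / y - 1 / (y - 1)) +
        (Real.sin (Real.pi * y) / Real.pi) ^ 2 / y ^ 2) := by
  have h1 : ¬ ∃ m : ℕ, y = -((m : ℝ) + 1) := by
    rintro ⟨m, hm⟩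
    exact hy (-(m + 1)) (by rw [hm]; push_cast; ring)
  have h2 : ¬ ∃ m : ℕ, y - 1 = -((m : ℝ) + 1) := by
    rintro ⟨m, hm⟩
    exact hy (-m) (by push_cast; linarith)
  have hs : Real.sin (Real.pi * (y - 1)) = -Real.sin (Real.pi * y) := by
    rw [mul_sub, mul_one, Real.sin_sub_pi]
  have ht : ∑' n : ℕ, 1 / (((n : ℝ) + 1) + (y - 1)) ^ 2
      = 1 / y ^ 2 + ∑' n : ℕ, 1 / (((n : ℝ) + 1) + y) ^ 2 := by
    rw [(summable_one_div_nat_add_one_add_sq (y - 1)).tsum_eq_zero_add]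
    congr 1
    · simp
    · congr 1 with n
      push_cast
      ring
  rw [beurlingB, beurlingB, if_neg h1, if_neg h2, hs, ht]
  ring

theorem beurlingB_sub_one_sub_ae :
    (fun y : ℝ => ((beurlingB (y - 1) - beurlingB y : ℝ) : ℂ)) =ᵐ[volume]
      fun y => (-2 : ℂ) * (𝓕 sineBump y + 𝓕 triangle y) := by
  filter_upwards [(Set.countable_range (fun k : ℤ => (k : ℝ))).ae_notMem volume] with y hy
  have hy' : ∀ k : ℤ, y ≠ k := fun k hk => hy ⟨k, hk.symm⟩
  have h0 : y ≠ 0 := by simpa using hy' 0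
  have h1 : y - 1 ≠ 0 := sub_ne_zero.2 (by simpa using hy' 1)
  rw [fourier_sineBump h0 h1, fourier_triangle h0, beurlingB_sub_one_sub hy']
  push_cast
  ring

theorem integrable_beurlingB_sub_one_sub :
    Integrable fun y : ℝ => beurlingB (y - 1) - beurlingB y := by
  have := ((integrable_fourier_sineBump.add integrable_fourier_triangle).const_mul (-2)).congr
    beurlingB_sub_one_sub_ae.symm
  simpa using this.re

theorem fourierT_beurlingB_sub_one_sub {t : ℝ} (ht : 1 ≤ |t|) :
    fourierT (fun y => beurlingB (y - 1) - beurlingB y) t = 0 := by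
  have h1 := fourier_fourier_eq_zero continuous_sineBump (fun t => sineBump_eq_zero)
    integrable_fourier_sineBump ht
  have h2 := fourier_fourier_eq_zero continuous_triangle (fun t => triangle_eq_zero)
    integrable_fourier_triangle ht
  have i1 := (Real.fourierIntegral_convergent_iff t).2 integrable_fourier_sineBump
  have i2 := (Real.fourierIntegral_convergent_iff t).2 integrable_fourier_triangle
  rw [fourierT_eq_fourier, Real.fourier_congr_ae beurlingB_sub_one_sub_ae]
  rw [Real.fourier_eq] at h1 h2 ⊢
  simp only [← smul_eq_mul (-2 : ℂ), smul_comm _ (-2 : ℂ), smul_add]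
  rw [integral_add (by exact i1.smul (-2 : ℂ)) (by exact i2.smul (-2 : ℂ)), integral_smul, integral_smul, h1, h2]
  simp

theorem fourierT_comp_mul_add (f : ℝ → ℝ) {c : ℝ} (hc : c ≠ 0) (d x : ℝ) :
    fourierT (fun u => f (c * u + d)) x =
      |c⁻¹| * Complex.exp (2 * Real.pi * (d * x / c) * Complex.I) * fourierT f (x / c) := by
  let G : ℝ → ℂ := fun v => Complex.exp (2 * Real.pi * (d * x / c) * Complex.I) *
    ((f v : ℂ) * Complex.exp (-(2 * Real.pi * v * (x / c : ℝ)) * Complex.I))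
  have hcc : (c : ℂ) ≠ 0 := by exact_mod_cast hc
  calc fourierT (fun u => f (c * u + d)) x = ∫ u : ℝ, (fun w => G (w + d)) (c * u) := by
        unfold fourierT
        congr 1 with u
        simp only [G]
        rw [mul_left_comm, ← Complex.exp_add]
        congr 2
        push_cast
        field_simp
        ring
    _ = |c⁻¹| * Complex.exp (2 * Real.pi * (d * x / c) * Complex.I) * fourierT f (x / c) := by
        rw [Measure.integral_comp_mul_left (fun w => G (w + d)), integral_add_right_eq_self G, integral_const_mul,
          Complex.real_smul, ← mul_assoc]
        rfl

theorem fourierT_sub {f g : ℝ → ℝ} (hf : Integrable f) (hg : Integrable g) (x : ℝ) :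
    fourierT (fun u => f u - g u) x = fourierT f x - fourierT g x := by
  have hf' : Integrable (fun u => (f u : ℂ)) := hf.ofReal
  have i1 := (Real.fourierIntegral_convergent_iff x).2 hf'
  have hg' : Integrable (fun u => (g u : ℂ)) := hg.ofReal
  have i2 := (Real.fourierIntegral_convergent_iff x).2 hg'
  simp only [fourierT_eq_fourier, Real.fourier_eq]
  rw [← integral_sub i1 i2]
  simp only [Complex.ofReal_sub, smul_sub]

theorem fourierT_beurlingB_add_of_integrable {a b : ℝ}
    (hf : Integrable fun x : ℝ => beurlingB (a - x) + beurlingB (x - b)) {t : ℝ} (ht : 1 ≤ |t|)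
    (hirr : Irrational t) :
    fourierT (fun x => beurlingB (a - x) + beurlingB (x - b)) t = 0 := by
  set f : ℝ → ℝ := fun x => beurlingB (a - x) + beurlingB (x - b) with hfdef
  set D : ℝ → ℝ := fun y => beurlingB (y - 1) - beurlingB y with hD
  have hshift : fourierT (fun x => f (1 * x + -1)) t - fourierT f t = 0 := by
    have hDi : Integrable D := integrable_beurlingB_sub_one_sub
    have hD1 : Integrable fun x => D (1 * x + -b) := by
      simpa only [one_mul] using hDi.comp_add_right (-b)
    have hD2 : Integrable fun x => D (-1 * x + (a + 1)) := by
      simpa only [neg_one_mul, neg_add_eq_sub] using hDi.comp_sub_left (a + 1)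
    have hf1 : Integrable fun x => f (1 * x + -1) := by
      simpa only [one_mul] using hf.comp_add_right (-1)
    have heq : (fun x => f (1 * x + -1) - f x)
        = fun x => D (1 * x + -b) - D (-1 * x + (a + 1)) := by
      funext x
      simp only [hfdef, hD]
      ring_nf
    rw [← fourierT_sub hf1 hf, heq, fourierT_sub hD1 hD2,
      fourierT_comp_mul_add D one_ne_zero, fourierT_comp_mul_add D (by norm_num),
      fourierT_beurlingB_sub_one_sub (by simpa using ht),
      fourierT_beurlingB_sub_one_sub (by simpa [abs_div] using ht)]
    simp
  rw [fourierT_comp_mul_add f one_ne_zero, div_one, ← sub_one_mul] at hshift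
  refine (mul_eq_zero.1 hshift).resolve_left fun h => ?_
  rw [inv_one, abs_one, Complex.ofReal_one, one_mul, sub_eq_zero, Complex.exp_eq_one_iff] at h
  obtain ⟨n, hn⟩ := h
  have hpi : (Real.pi : ℂ) ≠ 0 := by exact_mod_cast Real.pi_ne_zero
  have hI := Complex.I_ne_zero
  have h3 : (-t : ℂ) = n := by
    have h2 : (2 * Real.pi * Complex.I) * (-t : ℂ) = (2 * Real.pi * Complex.I) * n := by
      push_cast at hn
      linear_combination hn
    exact mul_left_cancel₀ (by simp [hpi]) h2
  have h4 : t = ((-n : ℤ) : ℝ) := by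
    have : -t = (n : ℝ) := by exact_mod_cast h3
    push_cast
    linarith
  exact hirr.ne_int _ h4

theorem mem_closure_one_lt_abs_irrational {t : ℝ} (ht : 1 ≤ |t|) :
    t ∈ closure ({s : ℝ | 1 < |s|} ∩ {s | Irrational s}) := by
  have hopen : IsOpen {s : ℝ | 1 < |s|} := isOpen_lt continuous_const continuous_abs
  have hsub := dense_irrational.open_subset_closure_inter hopen
  rcases le_abs.1 ht with h | h
  · refine closure_minimal (s := Set.Ioi 1) (fun s hs => hsub (lt_abs.2 (.inl hs)))
      isClosed_closure ?_
    rwa [closure_Ioi]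
  · refine closure_minimal (s := Set.Iio (-1))
      (fun s hs => hsub (lt_abs.2 (.inr (lt_neg_of_lt_neg hs)))) isClosed_closure ?_
    rw [closure_Iio]
    exact le_neg_of_le_neg h

theorem fourierT_beurlingB_add (a b : ℝ) {t : ℝ} (ht : 1 ≤ |t|) :
    fourierT (fun x => beurlingB (a - x) + beurlingB (x - b)) t = 0 := by
  by_cases hf : Integrable fun x : ℝ => beurlingB (a - x) + beurlingB (x - b)
  · have hcont : Continuous (fourierT fun x => beurlingB (a - x) + beurlingB (x - b)) := by
      have : fourierT (fun x => beurlingB (a - x) + beurlingB (x - b)) = _ :=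
        funext fun x => fourierT_eq_fourier _ x
      rw [this]
      exact VectorFourier.fourierIntegral_continuous Real.continuous_fourierChar
        (by exact continuous_inner) hf.ofReal
    have hsub : {s : ℝ | 1 < |s|} ∩ {s | Irrational s} ⊆
        {s | fourierT (fun x => beurlingB (a - x) + beurlingB (x - b)) s = 0} :=
      fun s hs => fourierT_beurlingB_add_of_integrable hf hs.1.le hs.2
    exact closure_minimal hsub (isClosed_eq hcont continuous_const)
      (mem_closure_one_lt_abs_irrational ht)
  · rw [fourierT_eq_fourier, Real.fourier_eq]
    apply integral_undef
    rw [Real.fourierIntegral_convergent_iff]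
    intro h
    exact hf (by simpa using h.re)

theorem fourierT_const_mul (r : ℝ) (f : ℝ → ℝ) (x : ℝ) :
    fourierT (fun u => r * f u) x = r * fourierT f x := by
  simp only [fourierT, Complex.ofReal_mul, mul_assoc, integral_const_mul]

/-- The Fourier transform of the Selberg minorant with parameter `δ` vanishes outside
`(-δ, δ)`. -/
theorem fourierT_selbergMinus_eq_zero (α β : ℝ) {δ : ℝ} (hδ : 0 < δ) {x : ℝ} (hx : δ ≤ |x|) :
    fourierT (selbergMinus α β δ) x = 0 := by
  have hS : selbergMinus α β δ = fun u => -(1 / 2) *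
      (fun v => beurlingB (δ * α - v) + beurlingB (v - δ * β)) (δ * u + 0) := by
    funext u
    simp only [selbergMinus, add_zero, mul_sub]
  rw [hS, fourierT_const_mul,
    fourierT_comp_mul_add (fun v => beurlingB (δ * α - v) + beurlingB (v - δ * β)) hδ.ne',
    fourierT_beurlingB_add, mul_zero, mul_zero]
  rwa [abs_div, abs_of_pos hδ, le_div_iff₀ hδ, one_mul]

/-- with `δ = (log 2)/(2π)` and any real `α < β`, the Fourier
transform of the Selberg minorant for `[α, β]` with parameter `δ` vanishes at
`±(log n)/(2π)` for every integer `n ≥ 2`. -/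
theorem selbergMinus_fourier_vanishes_at_log (α β : ℝ) (hαβ : α < β) :
    ∀ n : ℕ, 2 ≤ n →
      fourierT (selbergMinus α β (Real.log 2 / (2 * Real.pi)))
          (Real.log n / (2 * Real.pi)) = 0 ∧
      fourierT (selbergMinus α β (Real.log 2 / (2 * Real.pi)))
          (-(Real.log n / (2 * Real.pi))) = 0 := by
  intro n hn
  have hδ : 0 < Real.log 2 / (2 * Real.pi) :=
    div_pos (Real.log_pos one_lt_two) Real.two_pi_pos
  have hle : Real.log 2 / (2 * Real.pi) ≤ |Real.log n / (2 * Real.pi)| := by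
    refine le_trans ?_ (le_abs_self _)
    gcongr
    exact_mod_cast hn
  exact ⟨fourierT_selbergMinus_eq_zero α β hδ hle,
    fourierT_selbergMinus_eq_zero α β hδ (by rwa [abs_neg])⟩
end
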